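/- arXiv:1912.00204 — 2 statements merged into one kernel-verified Lean document; each statement's English description precedes it below -/
import Mathlib

section
/- Let P ∈ ℂ[T] be a polynomial of degree at least 1. Write R = Re(P(X+iY)) and I = Im(P(X+iY)), viewed as elements of the real polynomial ring ℝ[X,Y] in two variables. Then ℝ[X,Y] is integral over the ℝ-subalgebra generated by R and I; equivalently, the induced polynomial map ℝ² → ℝ², (x,y) ↦ (Re P(x+iy), Im P(x+iy)), is a finite morphism. -/
open Polynomial in
/-- An element `z` of an algebra over a field `K` is integral over `A` as soon as constants are
integral over `A` and some nonconstant polynomial over `K` takes an integral value at `z`. -/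
theorem IsIntegral.of_aeval_of_degree_pos {A K S : Type*} [CommRing A] [Field K] [CommRing S]
    [Algebra A S] [Algebra K S] (hK : ∀ c : K, IsIntegral A (algebraMap K S c))
    {p : K[X]} (hp : 0 < p.degree) {z : S} (hz : IsIntegral A (aeval z p)) :
    IsIntegral A z := by
  have hp0 : p ≠ 0 := ne_zero_of_degree_gt hp
  let B := integralClosure A S
  let ι : K →+* B := (algebraMap K S).codRestrict B.toSubring hK
  let w : B := ⟨aeval z p, hz⟩
  obtain ⟨q, hqdef⟩ : ∃ q : K[X], q = p * C p.leadingCoeff⁻¹ := ⟨_, rfl⟩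
  have hq : q.Monic := hqdef ▸ monic_mul_leadingCoeff_inv hp0
  have hqd : 0 < q.degree := by
    rwa [hqdef, degree_mul_C (inv_ne_zero (leadingCoeff_ne_zero.mpr hp0))]
  have hι : (algebraMap B S).comp ι = algebraMap K S := rfl
  have hB : IsIntegral B z := by
    nontriviality S
    refine ⟨q.map ι - C (w * ι p.leadingCoeff⁻¹), ?_, ?_⟩
    · refine (hq.map ι).sub_of_left ?_
      rw [hq.degree_map]
      exact degree_C_le.trans_lt hqd
    · rw [eval₂_sub, eval₂_map, hι, eval₂_C, map_mul, ← RingHom.comp_apply, hι]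
      rw [hqdef, eval₂_mul, eval₂_C, ← aeval_def]
      exact sub_self _
  exact isIntegral_trans z hB

attribute [local instance] MvPolynomial.algebraMvPolynomial

namespace MvPolynomial

/-- Complex polynomials agreeing at all real points are equal. -/
theorem funext_ofReal {σ : Type*} {p q : MvPolynomial σ ℂ}
    (h : ∀ v : σ → ℝ, eval (fun i ↦ (v i : ℂ)) p = eval (fun i ↦ (v i : ℂ)) q) : p = q := by
  refine funext_set (fun _ ↦ Set.range ((↑) : ℝ → ℂ))
    (fun _ ↦ Set.infinite_range_of_injective Complex.ofReal_injective) fun x hx ↦ ?_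
  choose v hv using fun i ↦ hx i (Set.mem_univ i)
  obtain rfl : (fun i ↦ (v i : ℂ)) = x := _root_.funext hv
  exact h v

theorem eval_ofReal_map {σ : Type*} (v : σ → ℝ) (p : MvPolynomial σ ℝ) :
    eval (fun i ↦ (v i : ℂ)) (map Complex.ofRealHom p) = (eval v p : ℂ) := by
  rw [eval_map]
  exact (eval₂_comp Complex.ofRealHom v p).symm

/-- Complex conjugation of coefficients, as an algebra map over the real polynomials. -/
noncomputable def conjAlgHom (σ : Type*) :
    MvPolynomial σ ℂ →ₐ[MvPolynomial σ ℝ] MvPolynomial σ ℂ where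
  __ := map (starRingEnd ℂ)
  commutes' p := by
    change map (starRingEnd ℂ) (map (algebraMap ℝ ℂ) p) = map (algebraMap ℝ ℂ) p
    rw [map_map]
    congr 2
    ext x
    exact Complex.conj_ofReal x

/-- The decomposition `P(X + iY) = R + iI` as an identity of complex polynomials. -/
theorem aeval_X_add_X_mul_I {P : Polynomial ℂ} {R I : MvPolynomial (Fin 2) ℝ}
    (hR : ∀ x y : ℝ, eval ![x, y] R = (P.eval ((x : ℂ) + (y : ℂ) * Complex.I)).re)
    (hI : ∀ x y : ℝ, eval ![x, y] I = (P.eval ((x : ℂ) + (y : ℂ) * Complex.I)).im) :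
    Polynomial.aeval (X 0 + X 1 * C Complex.I : MvPolynomial (Fin 2) ℂ) P =
      map Complex.ofRealHom R + map Complex.ofRealHom I * C Complex.I := by
  refine funext_ofReal fun v ↦ ?_
  have hv : v = ![v 0, v 1] := by ext i; fin_cases i <;> rfl
  rw [map_add, map_mul, eval_ofReal_map, eval_ofReal_map, hv, hR, hI, eval_C,
    Complex.re_add_im, ← hv, Polynomial.aeval_def, Polynomial.hom_eval₂]
  have : (eval fun i ↦ (v i : ℂ)).comp (algebraMap ℂ (MvPolynomial (Fin 2) ℂ)) =
      RingHom.id ℂ := by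
    ext; simp [algebraMap_eq]
  rw [this, Polynomial.eval₂_id]
  simp

end MvPolynomial

/-- For a complex polynomial `P` of degree at least 1, writing
`P(X+iY) = R(X,Y) + i·I(X,Y)` with `R, I ∈ ℝ[X,Y]`, the polynomial ring `ℝ[X,Y]` is
integral over the `ℝ`-subalgebra generated by `R` and `I`; i.e. the induced map
`ℝ² → ℝ²` is finite. -/
theorem stmt_0 (P : Polynomial ℂ) (hP : 1 ≤ P.degree)
    (R I : MvPolynomial (Fin 2) ℝ)
    (hR : ∀ x y : ℝ, MvPolynomial.eval ![x, y] R = (P.eval ((x : ℂ) + (y : ℂ) * Complex.I)).re)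
    (hI : ∀ x y : ℝ, MvPolynomial.eval ![x, y] I = (P.eval ((x : ℂ) + (y : ℂ) * Complex.I)).im) :
    ∀ f : MvPolynomial (Fin 2) ℝ,
      IsIntegral (Algebra.adjoin ℝ ({R, I} : Set (MvPolynomial (Fin 2) ℝ))) f := by
  let A := Algebra.adjoin ℝ ({R, I} : Set (MvPolynomial (Fin 2) ℝ))
  have hmap : ∀ p ∈ A,
      IsIntegral A (MvPolynomial.map Complex.ofRealHom p : MvPolynomial (Fin 2) ℂ) := fun p hp ↦
    isIntegral_algebraMap (R := A) (A := MvPolynomial (Fin 2) ℂ) (x := ⟨p, hp⟩)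
  have hi : IsIntegral A (MvPolynomial.C Complex.I : MvPolynomial (Fin 2) ℂ) := by
    refine IsIntegral.of_pow (n := 2) two_pos ?_
    rw [← map_pow, Complex.I_sq, map_neg, map_one]
    exact isIntegral_one.neg
  have hconst (c : ℂ) : IsIntegral A (algebraMap ℂ (MvPolynomial (Fin 2) ℂ) c) := by
    have hreal (r : ℝ) : IsIntegral A (MvPolynomial.C (r : ℂ) : MvPolynomial (Fin 2) ℂ) := by
      simpa using hmap (MvPolynomial.C r) (A.algebraMap_mem r)
    rw [MvPolynomial.algebraMap_eq, ← Complex.re_add_im c, map_add, map_mul]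
    exact (hreal _).add ((hreal _).mul hi)
  have hZ : IsIntegral A
      (MvPolynomial.X 0 + MvPolynomial.X 1 * MvPolynomial.C Complex.I : MvPolynomial (Fin 2) ℂ) := by
    refine .of_aeval_of_degree_pos hconst (p := P) (zero_lt_one.trans_le hP) ?_
    rw [MvPolynomial.aeval_X_add_X_mul_I hR hI]
    exact (hmap R (Algebra.subset_adjoin (by simp))).add
      ((hmap I (Algebra.subset_adjoin (by simp))).mul hi)
  have hW : IsIntegral A
      (MvPolynomial.X 0 - MvPolynomial.X 1 * MvPolynomial.C Complex.I : MvPolynomial (Fin 2) ℂ) := by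
    have h := hZ.map ((MvPolynomial.conjAlgHom (Fin 2)).restrictScalars A)
    have e : MvPolynomial.conjAlgHom (Fin 2)
        (MvPolynomial.X 0 + MvPolynomial.X 1 * MvPolynomial.C Complex.I) =
        MvPolynomial.X 0 - MvPolynomial.X 1 * MvPolynomial.C Complex.I := by
      change MvPolynomial.map (starRingEnd ℂ) _ = _
      simp [sub_eq_add_neg]
    rwa [AlgHom.restrictScalars_apply, e] at h
  have hX0 : IsIntegral A (MvPolynomial.X 0 : MvPolynomial (Fin 2) ℂ) := by
    have h := (hconst (1 / 2)).mul (hZ.add hW)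
    rwa [add_add_sub_cancel, ← two_mul, ← mul_assoc, ← map_ofNat (algebraMap ℂ (MvPolynomial (Fin 2) ℂ)) 2, ← map_mul,
      one_div, inv_mul_cancel₀ two_ne_zero, map_one, one_mul] at h
  have hX1 : IsIntegral A (MvPolynomial.X 1 : MvPolynomial (Fin 2) ℂ) := by
    have h := (hconst (-Complex.I)).mul (hZ.sub hX0)
    rwa [add_sub_cancel_left, MvPolynomial.algebraMap_eq, mul_left_comm, ← map_mul,
      neg_mul, Complex.I_mul_I, neg_neg, map_one, mul_one] at h
  have hX (i : Fin 2) : IsIntegral A (MvPolynomial.X i : MvPolynomial (Fin 2) ℝ) := by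
    have hinj : Function.Injective (algebraMap (MvPolynomial (Fin 2) ℝ) (MvPolynomial (Fin 2) ℂ)) :=
      MvPolynomial.map_injective _ (algebraMap ℝ ℂ).injective
    refine (isIntegral_algebraMap_iff hinj).mp ?_
    rw [MvPolynomial.algebraMap_def, MvPolynomial.map_X]
    fin_cases i
    exacts [hX0, hX1]
  intro f
  induction f using MvPolynomial.induction_on with
  | C r => exact isIntegral_algebraMap (R := A) (x := algebraMap ℝ A r)
  | add p q hp hq => exact hp.add hq
  | mul_X p i hp => exact hp.mul (hX i)
end

section
/- Let p be an odd prime and let S ⊆ (ℤ/pℤ)ˣ be the set of residue classes of 1, 2, …, (p−1)/2. If m ∈ (ℤ/pℤ)ˣ satisfies m·s ∈ S for every s ∈ S, then m = 1. -/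
/-- Let `p` be an odd prime and `S ⊆ (ℤ/pℤ)ˣ` the set of classes of `1, …, (p-1)/2`.
If `m ∈ (ℤ/pℤ)ˣ` satisfies `m·s ∈ S` for all `s ∈ S`, then `m = 1`. -/
theorem stmt_3 (p : ℕ) (hp : p.Prime) (hodd : Odd p)
    (S : Set (ZMod p)ˣ)
    (hS : S = {u : (ZMod p)ˣ | ∃ k : ℕ, 1 ≤ k ∧ k ≤ (p - 1) / 2 ∧ (u : ZMod p) = (k : ZMod p)})
    (m : (ZMod p)ˣ) (hm : ∀ s ∈ S, m * s ∈ S) : m = 1 := by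
  subst hS
  obtain ⟨h, rfl⟩ := hodd
  have hh : (2 * h + 1 - 1) / 2 = h := by omega
  simp only [hh, Set.mem_ofPred_eq, Units.val_mul] at hm
  have h_pos : 1 ≤ h := by
    have := hp.two_le
    omega
  obtain ⟨a, ha1, hah, hma⟩ := hm 1 ⟨1, le_rfl, h_pos, by simp⟩
  rw [Units.val_one, mul_one] at hma
  obtain rfl | ha2 : a = 1 ∨ 2 ≤ a := by omega
  · exact Units.ext (by simpa using hma)
  exfalso
  -- the least multiple `k * a` exceeding `h` is at most `2 * h`
  obtain ⟨k, hk⟩ : ∃ k, k = h / a + 1 := ⟨_, rfl⟩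
  have hk_le : k ≤ h := by
    have : h / a ≤ h / 2 := Nat.div_le_div_left ha2 (by norm_num)
    omega
  have hdiv := Nat.div_add_mod h a
  have hmod := Nat.mod_lt h (by omega : a > 0)
  have hak : a * k = a * (h / a) + a := by rw [hk]; ring
  have hcop : Nat.Coprime k (2 * h + 1) :=
    (Nat.coprime_of_lt_prime (by simp [hk]) (by omega) hp).symm
  obtain ⟨b, hb1, hbh, hb⟩ := hm (ZMod.unitOfCoprime k hcop)
    ⟨k, by rw [hk]; exact Nat.le_add_left 1 _, hk_le, ZMod.coe_unitOfCoprime k hcop⟩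
  rw [hma, ZMod.coe_unitOfCoprime, ← Nat.cast_mul, ZMod.natCast_eq_natCast_iff] at hb
  have := Nat.ModEq.eq_of_lt_of_lt hb (by omega) (by omega)
  omega
end
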